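/- arXiv:1708.01157 — 2 statements merged into one kernel-verified Lean document; each statement's English description precedes it below -/
import Mathlib

section
/- Let $P = (P_{ij})_{1 \leq i,j \leq 4}$ be a self-dual $\mathfrak{so}(m)$-valued 2-form, i.e. each $P_{ij}$ is a real skew-symmetric $m \times m$ matrix, $P_{ij} = -P_{ji}$, and $P_{12} = P_{34}$, $P_{13} = P_{42}$, $P_{14} = P_{23}$. Define $[P,P]_{ij} = \sum_{k=1}^4 \big( [P_{ik}, P_{jk}] - [P_{jk}, P_{ik}] \big) = 2\sum_{k=1}^4 [P_{ik}, P_{jk}]$. Then $\Big( \sum_{i,j=1}^4 \|[P,P]_{ij}\|_F^2 \Big)^{1/2} \leq \tfrac{2}{\sqrt{3}} \sum_{i,j=1}^4 \|P_{ij}\|_F^2$, where $\|\cdot\|_F$ is the Frobenius norm and $[A,B] = AB-BA$. -/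
open Matrix

/-- Frobenius norm of a real square matrix. -/
noncomputable def frobNorm {m : ℕ} (M : Matrix (Fin m) (Fin m) ℝ) : ℝ :=
  Real.sqrt (Matrix.trace (Mᵀ * M))

/-- A self-dual `𝔰𝔬(m)`-valued 2-form on `ℝ⁴` (indices here `0`-based). -/
def IsSelfDualForm {m : ℕ} (P : Fin 4 → Fin 4 → Matrix (Fin m) (Fin m) ℝ) : Prop :=
  (∀ i j, (P i j)ᵀ = -(P i j)) ∧ (∀ i j, P i j = -(P j i)) ∧
    P 0 1 = P 2 3 ∧ P 0 2 = P 3 1 ∧ P 0 3 = P 1 2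

/-- The self-bracket `[P,P]ᵢⱼ = 2 ∑ₖ [Pᵢₖ, Pⱼₖ]`. -/
def selfBracket {m : ℕ} (P : Fin 4 → Fin 4 → Matrix (Fin m) (Fin m) ℝ) :
    Fin 4 → Fin 4 → Matrix (Fin m) (Fin m) ℝ :=
  fun i j => 2 • ∑ k : Fin 4, (P i k * P j k - P j k * P i k)

open Matrix Complex

set_option linter.unusedSimpArgs false

lemma frob_sq {m : ℕ} (M : Matrix (Fin m) (Fin m) ℝ) :
    frobNorm M ^ 2 = ∑ i, ∑ j, M i j ^ 2 := by
  unfold frobNorm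
  have h : Matrix.trace (Mᵀ * M) = ∑ i, ∑ j, M i j ^ 2 := by
    simp only [Matrix.trace, Matrix.diag, Matrix.mul_apply, Matrix.transpose_apply]
    rw [Finset.sum_comm]
    simp [sq]
  rw [h, Real.sq_sqrt]
  positivity

/-- Sum of squared absolute values of the entries. -/
noncomputable def cfrob {m : ℕ} (M : Matrix (Fin m) (Fin m) ℂ) : ℝ :=
  ∑ i, ∑ j, Complex.normSq (M i j)

lemma cfrob_trace {m : ℕ} (M : Matrix (Fin m) (Fin m) ℂ) :
    (cfrob M : ℂ) = Matrix.trace (Mᴴ * M) := by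
  simp only [cfrob, Matrix.trace, Matrix.diag, Matrix.mul_apply, Matrix.conjTranspose_apply]
  rw [Finset.sum_comm]
  push_cast
  simp [Complex.normSq_eq_conj_mul_self]

lemma cfrob_conj {m : ℕ} (M U : Matrix (Fin m) (Fin m) ℂ) (hU : U * Uᴴ = 1) :
    cfrob (Uᴴ * M * U) = cfrob M := by
  apply Complex.ofReal_injective
  rw [cfrob_trace, cfrob_trace]
  have : (Uᴴ * M * U)ᴴ * (Uᴴ * M * U) = Uᴴ * (Mᴴ * M * U) := by
    simp only [Matrix.conjTranspose_mul, Matrix.conjTranspose_conjTranspose]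
    calc Uᴴ * (Mᴴ * U) * (Uᴴ * M * U) = Uᴴ * Mᴴ * (U * Uᴴ) * M * U := by
          simp only [Matrix.mul_assoc]
      _ = _ := by rw [hU]; simp only [Matrix.mul_assoc, Matrix.mul_one]
  rw [this, Matrix.trace_mul_comm, Matrix.mul_assoc, hU, Matrix.mul_one]

lemma cfrob_map {m : ℕ} (M : Matrix (Fin m) (Fin m) ℝ) :
    cfrob (M.map Complex.ofReal) = frobNorm M ^ 2 := by
  rw [frob_sq]
  simp [cfrob, Complex.normSq_ofReal, sq]

lemma skew_diag {m : ℕ} (N : Matrix (Fin m) (Fin m) ℂ) (h : Nᵀ = -N) (l : Fin m) :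
    N l l = 0 := by
  have := congrFun (congrFun h l) l
  simp only [Matrix.transpose_apply, Matrix.neg_apply] at this
  exact self_eq_neg.mp this

/-- Numerical part: four distinct indices. -/
lemma four_le {m : ℕ} (μ : Fin m → ℝ) (k l k' l' : Fin m) (hl : l' ≠ l) (hk : k' ≠ k)
    (hml : μ l' = - μ k) (hmk : μ k' = - μ l) : (μ k - μ l) ^ 2 ≤ ∑ j, μ j ^ 2 := by
  by_cases hkl : k = l
  · subst hkl
    rw [sub_self, zero_pow two_ne_zero]
    positivity
  by_cases hs : 0 ≤ μ k * μ l
  · have : ∑ j ∈ ({k, l} : Finset (Fin m)), μ j ^ 2 ≤ ∑ j, μ j ^ 2 :=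
      Finset.sum_le_sum_of_subset_of_nonneg (Finset.subset_univ _) (fun _ _ _ => sq_nonneg _)
    rw [Finset.sum_pair hkl] at this
    nlinarith
  · push Not at hs
    have h1 : k ≠ l' := by
      rintro rfl
      have : μ k = 0 := by linarith
      simp [this] at hs
    have h2 : l ≠ k' := by
      rintro rfl
      have : μ l = 0 := by linarith
      simp [this] at hs
    have h3 : k' ≠ l' := by
      rintro rfl
      have : μ k = μ l := by linarith
      rw [this] at hs
      nlinarith [mul_self_nonneg (μ l)]
    have : ∑ j ∈ ({k, l, k', l'} : Finset (Fin m)), μ j ^ 2 ≤ ∑ j, μ j ^ 2 :=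
      Finset.sum_le_sum_of_subset_of_nonneg (Finset.subset_univ _) (fun _ _ _ => sq_nonneg _)
    rw [Finset.sum_insert (by simp [hkl, hk.symm, h1]), Finset.sum_insert (by simp [h2, hl.symm]),
      Finset.sum_pair h3, hml, hmk] at this
    nlinarith [sq_nonneg (μ k + μ l)]

/-- Core estimate in an eigenbasis. -/
lemma core {m : ℕ} (H B U : Matrix (Fin m) (Fin m) ℂ) (μ : Fin m → ℝ)
    (hU : U * Uᴴ = 1) (hU' : Uᴴ * U = 1)
    (hHU : H * U = U * Matrix.diagonal (fun i => (μ i : ℂ)))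
    (hH : Hᵀ = -H) (hB : Bᵀ = -B) :
    cfrob (H * B - B * H) ≤ cfrob H * cfrob B := by
  set D : Matrix (Fin m) (Fin m) ℂ := Matrix.diagonal (fun i => (μ i : ℂ)) with hD
  set W : Matrix (Fin m) (Fin m) ℂ := Uᵀ * U with hW
  set K : Matrix (Fin m) (Fin m) ℂ := Uᴴ * B * U with hK
  have hHd : Uᴴ * H * U = D := by rw [Matrix.mul_assoc, hHU, ← Matrix.mul_assoc, hU', Matrix.one_mul]
  have hUH : Uᴴ * H = D * Uᴴ := by
    rw [← hHd, Matrix.mul_assoc _ U, hU, Matrix.mul_one]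
  have hWD : D * W = -(W * D) := by
    have h1 := congrArg Matrix.transpose hHU
    rw [Matrix.transpose_mul, Matrix.transpose_mul, hH, hD, Matrix.diagonal_transpose, ← hD] at h1
    rw [hW, ← Matrix.mul_assoc, ← h1, Matrix.mul_assoc, Matrix.mul_assoc, Matrix.neg_mul, hHU,
      Matrix.mul_neg]
  have hW0 : ∀ i j, W i j ≠ 0 → μ i = - μ j := by
    intro i j h
    have h1 := congrFun (congrFun hWD i) j
    rw [hD, Matrix.neg_apply, Matrix.diagonal_mul, Matrix.mul_diagonal] at h1
    have h2 : ((μ i : ℂ) + μ j) * W i j = 0 := by rw [add_mul, h1]; ring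
    have h3 := (mul_eq_zero.mp h2).resolve_right h
    have : μ i + μ j = 0 := by exact_mod_cast h3
    linarith
  have hc : cfrob (H * B - B * H) = ∑ k, ∑ l, (μ k - μ l) ^ 2 * Complex.normSq (K k l) := by
    rw [← cfrob_conj _ U hU]
    have : Uᴴ * (H * B - B * H) * U = D * K - K * D := by
      rw [Matrix.mul_sub, Matrix.sub_mul, hK]
      congr 1
      · rw [← Matrix.mul_assoc, hUH]; simp only [Matrix.mul_assoc]
      · simp only [Matrix.mul_assoc, hHU]
    rw [this, cfrob]
    refine Finset.sum_congr rfl fun k _ => Finset.sum_congr rfl fun l _ => ?_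
    rw [Matrix.sub_apply, hD, Matrix.diagonal_mul, Matrix.mul_diagonal]
    have : (μ k : ℂ) * K k l - K k l * μ l = ((μ k - μ l : ℝ) : ℂ) * K k l := by
      push_cast; ring
    rw [this, Complex.normSq_mul, Complex.normSq_ofReal]
    ring
  have hcH : cfrob H = ∑ j, μ j ^ 2 := by
    rw [← cfrob_conj _ U hU, hHd, cfrob]
    refine Finset.sum_congr rfl fun k _ => ?_
    rw [Finset.sum_eq_single k]
    · simp [hD, Complex.normSq_ofReal, sq]
    · intro j _ hj
      simp [hD, Matrix.diagonal_apply_ne' _ hj]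
    · simp
  rw [hc, hcH, ← cfrob_conj B U hU, ← hK, cfrob, Finset.mul_sum]
  refine Finset.sum_le_sum fun k _ => ?_
  rw [Finset.mul_sum]
  refine Finset.sum_le_sum fun l _ => ?_
  by_cases hkl : K k l = 0
  · simp [hkl]
  refine mul_le_mul_of_nonneg_right ?_ (Complex.normSq_nonneg _)
  have hUt : (Uᴴ)ᵀ * Uᵀ = 1 := by rw [← Matrix.transpose_mul, hU, Matrix.transpose_one]
  have hWH : Wᴴ = Uᴴ * (Uᴴ)ᵀ := by
    rw [hW, Matrix.conjTranspose_mul]; rfl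
  -- first representation
  have e1 : K = Wᴴ * (Uᵀ * B * U) := by
    rw [hWH, hK]
    calc Uᴴ * B * U = Uᴴ * ((Uᴴ)ᵀ * Uᵀ) * B * U := by rw [hUt, Matrix.mul_one]
      _ = _ := by simp only [Matrix.mul_assoc]
  have e2 : K = (Uᴴ * B * (Uᴴ)ᵀ) * W := by
    rw [hW, hK]
    calc Uᴴ * B * U = Uᴴ * B * ((Uᴴ)ᵀ * Uᵀ) * U := by rw [hUt, Matrix.mul_one]
      _ = _ := by simp only [Matrix.mul_assoc]
  have s1 := skew_diag (Uᵀ * B * U) (by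
    simp [Matrix.transpose_mul, hB, Matrix.mul_assoc]) l
  have s2 := skew_diag (Uᴴ * B * (Uᴴ)ᵀ) (by
    simp [Matrix.transpose_mul, hB, Matrix.mul_assoc]) k
  obtain ⟨l', hl', hl⟩ : ∃ l', l' ≠ l ∧ μ l' = - μ k := by
    by_contra! hcon
    apply hkl
    rw [e1, Matrix.mul_apply]
    refine Finset.sum_eq_zero fun j _ => ?_
    by_cases hj : j = l
    · rw [hj, s1, mul_zero]
    · have : W j k = 0 := by
        by_contra h
        exact hcon j hj (hW0 _ _ h)
      simp [Matrix.conjTranspose_apply, this]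
  obtain ⟨k', hk', hk⟩ : ∃ k', k' ≠ k ∧ μ k' = - μ l := by
    by_contra! hcon
    apply hkl
    rw [e2, Matrix.mul_apply]
    refine Finset.sum_eq_zero fun j _ => ?_
    by_cases hj : j = k
    · rw [hj, s2, zero_mul]
    · have : W j l = 0 := by
        by_contra h
        exact hcon j hj (hW0 _ _ h)
      simp [this]
  exact four_le μ k l k' l' hl' hk' hl hk

/-- The commutator estimate for skew matrices. -/
lemma comm_le {m : ℕ} (A B : Matrix (Fin m) (Fin m) ℝ) (hA : Aᵀ = -A) (hB : Bᵀ = -B) :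
    frobNorm (A * B - B * A) ^ 2 ≤ frobNorm A ^ 2 * frobNorm B ^ 2 := by
  have hmA : ∀ i j, A j i = - A i j := fun i j => congrFun (congrFun hA i) j
  have hmB : ∀ i j, B j i = - B i j := fun i j => congrFun (congrFun hB i) j
  set H : Matrix (Fin m) (Fin m) ℂ := Complex.I • A.map Complex.ofReal with hH
  have hherm : H.IsHermitian := by
    ext i j
    simp [hH, Matrix.conjTranspose_apply, hmA i j]
  have hI : ∀ M : Matrix (Fin m) (Fin m) ℂ, cfrob (Complex.I • M) = cfrob M := by
    intro M
    simp [cfrob]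
  have hU := hherm.eigenvectorUnitary.2
  have key := core H (B.map Complex.ofReal) (hherm.eigenvectorUnitary : Matrix (Fin m) (Fin m) ℂ)
    hherm.eigenvalues (Matrix.mem_unitaryGroup_iff.mp hU) (Matrix.mem_unitaryGroup_iff'.mp hU)
    (by
      have h := hherm.spectral_theorem
      ext i j
      have h2 := congrFun (hherm.mulVec_eigenvectorBasis j) i
      rw [Matrix.mul_diagonal]
      simp only [Matrix.mulVec, dotProduct, Pi.smul_apply] at h2
      simp only [Matrix.mul_apply, Matrix.IsHermitian.eigenvectorUnitary_apply]
      rw [h2, Complex.real_smul, mul_comm])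
    (by ext i j; simp [hH, hmA i j])
    (by ext i j; simp [hmB i j])
  have e : H * B.map Complex.ofReal - B.map Complex.ofReal * H
      = Complex.I • ((A * B - B * A).map Complex.ofReal) := by
    have h1 := Matrix.map_mul (L := A) (M := B) (f := Complex.ofRealHom)
    have h2 := Matrix.map_mul (L := B) (M := A) (f := Complex.ofRealHom)
    have h3 := Matrix.map_sub (Complex.ofReal) Complex.ofReal_sub (A * B) (B * A)
    rw [h3]
    change (A * B).map Complex.ofReal = A.map Complex.ofReal * B.map Complex.ofReal at h1
    change (B * A).map Complex.ofReal = B.map Complex.ofReal * A.map Complex.ofReal at h2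
    rw [h1, h2, hH, smul_sub, Matrix.smul_mul, Matrix.mul_smul]
  rw [e, hI, hH, hI, cfrob_map, cfrob_map, cfrob_map] at key
  exact key

lemma frob_smul {m : ℕ} (c : ℝ) (M : Matrix (Fin m) (Fin m) ℝ) :
    frobNorm (c • M) ^ 2 = c ^ 2 * frobNorm M ^ 2 := by
  simp [frob_sq, Finset.mul_sum, mul_pow]

lemma frob_neg {m : ℕ} (M : Matrix (Fin m) (Fin m) ℝ) :
    frobNorm (-M) = frobNorm M := by
  simp [frobNorm]

/-- Lemma 2.6 of the paper combined with `γ₀ ≤ √2`: for a self-dual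
`𝔰𝔬(m)`-valued 2-form `P`, `|[P,P]| ≤ (2/√3) |P|²` (in Frobenius norms). -/
theorem selfBracket_norm_le {m : ℕ}
    (P : Fin 4 → Fin 4 → Matrix (Fin m) (Fin m) ℝ) (hP : IsSelfDualForm P) :
    Real.sqrt (∑ i : Fin 4, ∑ j : Fin 4, frobNorm (selfBracket P i j) ^ 2) ≤
      (2 / Real.sqrt 3) * ∑ i : Fin 4, ∑ j : Fin 4, frobNorm (P i j) ^ 2 := by
  obtain ⟨hs, ha, h1, h2, h3⟩ := hP
  have hz : ∀ i, P i i = 0 := by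
    intro i
    ext a b
    exact self_eq_neg.mp (congrFun (congrFun (ha i i) a) b)
  obtain ⟨A, hA⟩ : ∃ A, A = P 0 1 := ⟨_, rfl⟩
  obtain ⟨B, hB⟩ : ∃ B, B = P 0 2 := ⟨_, rfl⟩
  obtain ⟨C, hC⟩ : ∃ C, C = P 0 3 := ⟨_, rfl⟩
  have q01 : P 0 1 = A := hA.symm
  have q02 : P 0 2 = B := hB.symm
  have q03 : P 0 3 = C := hC.symm
  have q23 : P 2 3 = A := by rw [← h1, hA]
  have q31 : P 3 1 = B := by rw [← h2, hB]
  have q12 : P 1 2 = C := by rw [← h3, hC]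
  have q10 : P 1 0 = -A := by rw [ha, q01]
  have q20 : P 2 0 = -B := by rw [ha, q02]
  have q30 : P 3 0 = -C := by rw [ha, q03]
  have q32 : P 3 2 = -A := by rw [ha, q23]
  have q13 : P 1 3 = -B := by rw [ha, q31]
  have q21 : P 2 1 = -C := by rw [ha, q12]
  have sA : Aᵀ = -A := hA ▸ hs 0 1
  have sB : Bᵀ = -B := hB ▸ hs 0 2
  have sC : Cᵀ = -C := hC ▸ hs 0 3
  have kAB := comm_le A B sA sB
  have kBC := comm_le B C sB sC
  have kCA := comm_le C A sC sA
  have z : frobNorm (0 : Matrix (Fin m) (Fin m) ℝ) ^ 2 = 0 := by simp [frobNorm]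
  have rhs : ∑ i : Fin 4, ∑ j : Fin 4, frobNorm (P i j) ^ 2
      = 4 * (frobNorm A ^ 2 + frobNorm B ^ 2 + frobNorm C ^ 2) := by
    simp only [Fin.sum_univ_four, hz, q01, q02, q03, q10, q12, q13, q20, q21, q23, q30, q31, q32,
      frob_neg, z]
    ring
  have d : ∀ i, selfBracket P i i = 0 := by intro i; simp [selfBracket]
  have b : ∀ i j, selfBracket P i j = - selfBracket P j i := by
    intro i j
    simp only [selfBracket, Fin.sum_univ_four]
    module
  have b01 : selfBracket P 0 1 = (4 : ℝ) • (B * C - C * B) := by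
    simp only [selfBracket, Fin.sum_univ_four, hz, q01, q02, q03, q10, q12, q13, q20, q21, q23,
      q30, q31, q32, Matrix.mul_neg, Matrix.neg_mul, Matrix.mul_zero, Matrix.zero_mul]
    module
  have b23 : selfBracket P 2 3 = (4 : ℝ) • (B * C - C * B) := by
    simp only [selfBracket, Fin.sum_univ_four, hz, q01, q02, q03, q10, q12, q13, q20, q21, q23,
      q30, q31, q32, Matrix.mul_neg, Matrix.neg_mul, Matrix.mul_zero, Matrix.zero_mul]
    module
  have b02 : selfBracket P 0 2 = (4 : ℝ) • (C * A - A * C) := by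
    simp only [selfBracket, Fin.sum_univ_four, hz, q01, q02, q03, q10, q12, q13, q20, q21, q23,
      q30, q31, q32, Matrix.mul_neg, Matrix.neg_mul, Matrix.mul_zero, Matrix.zero_mul]
    module
  have b31 : selfBracket P 3 1 = (4 : ℝ) • (C * A - A * C) := by
    simp only [selfBracket, Fin.sum_univ_four, hz, q01, q02, q03, q10, q12, q13, q20, q21, q23,
      q30, q31, q32, Matrix.mul_neg, Matrix.neg_mul, Matrix.mul_zero, Matrix.zero_mul]
    module
  have b03 : selfBracket P 0 3 = (4 : ℝ) • (A * B - B * A) := by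
    simp only [selfBracket, Fin.sum_univ_four, hz, q01, q02, q03, q10, q12, q13, q20, q21, q23,
      q30, q31, q32, Matrix.mul_neg, Matrix.neg_mul, Matrix.mul_zero, Matrix.zero_mul]
    module
  have b12 : selfBracket P 1 2 = (4 : ℝ) • (A * B - B * A) := by
    simp only [selfBracket, Fin.sum_univ_four, hz, q01, q02, q03, q10, q12, q13, q20, q21, q23,
      q30, q31, q32, Matrix.mul_neg, Matrix.neg_mul, Matrix.mul_zero, Matrix.zero_mul]
    module
  have lhs : ∑ i : Fin 4, ∑ j : Fin 4, frobNorm (selfBracket P i j) ^ 2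
      = 64 * (frobNorm (A * B - B * A) ^ 2 + frobNorm (B * C - C * B) ^ 2
        + frobNorm (C * A - A * C) ^ 2) := by
    simp only [Fin.sum_univ_four, d, b 1 0, b 2 0, b 3 0, b 2 1, b 1 3, b 3 2, b01, b23, b02, b31,
      b03, b12, frob_neg, frob_smul, z]
    ring
  rw [lhs, rhs]
  apply Real.sqrt_le_iff.mpr
  refine ⟨by positivity, ?_⟩
  rw [mul_pow, div_pow, Real.sq_sqrt (by norm_num)]
  nlinarith [sq_nonneg (frobNorm A ^ 2 - frobNorm B ^ 2), sq_nonneg (frobNorm B ^ 2 - frobNorm C ^ 2),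
    sq_nonneg (frobNorm C ^ 2 - frobNorm A ^ 2)]
end

section
/- Let $V$ be a real inner product space and let $\omega : \mathbb{R}^4 \to V^{4 \times 4}$ be a twice continuously differentiable family $\omega = (\omega_{ij})_{1 \leq i,j \leq 4}$ of $V$-valued functions with $\omega_{ij} = -\omega_{ji}$, which is closed and co-closed: for all $x$ and all indices, $\partial_i \omega_{jk}(x) + \partial_j \omega_{ki}(x) + \partial_k \omega_{ij}(x) = 0$ and $\sum_{i=1}^4 \partial_i \omega_{ij}(x) = 0$. Define $|\omega|(x) = \big(\sum_{i,j} \|\omega_{ij}(x)\|_V^2\big)^{1/2}$. Then at every point $x$ where $\omega(x) \neq 0$, the function $|\omega|$ is differentiable and the improved Kato inequality holds: $\sum_{k=1}^4 \sum_{i,j=1}^4 \|\partial_k \omega_{ij}(x)\|_V^2 \geq \tfrac{3}{2} \, \|\nabla |\omega|(x)\|^2$, where $\nabla|\omega|(x) \in \mathbb{R}^4$ is the gradient of $|\omega|$ at $x$. -/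
open EuclideanSpace

section KatoAux

variable {V : Type*} [NormedAddCommGroup V] [InnerProductSpace ℝ V]

lemma kato_two (a b c : V) (h : a + b + c = 0) : ‖a‖ ^ 2 ≤ 2 * (‖b‖ ^ 2 + ‖c‖ ^ 2) := by
  have ha : a = -(b + c) := by
    rw [eq_neg_iff_add_eq_zero, ← h]; abel
  have h1 := parallelogram_law_with_norm ℝ b c
  have h2 := mul_self_nonneg ‖b - c‖
  rw [ha, norm_neg]
  nlinarith

/-- The inequality in an adapted frame. -/
lemma kato_base (T : Fin 4 → Fin 4 → Fin 4 → V)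
    (ha : ∀ k i j, T k i j = - T k j i)
    (hc : ∀ i j k, T i j k + T j k i + T k i j = 0)
    (hd : ∀ j, ∑ i, T i i j = 0) :
    3 / 2 * ∑ i, ∑ j, ‖T 0 i j‖ ^ 2 ≤ ∑ k, ∑ i, ∑ j, ‖T k i j‖ ^ 2 := by
  have hz : ∀ k i, ‖T k i i‖ = 0 := by
    intro k i
    have h2 : (2 : ℝ) • T k i i = 0 := by
      rw [two_smul]; nth_rewrite 1 [ha k i i]; exact neg_add_cancel _
    have := (smul_eq_zero.mp h2).resolve_left two_ne_zero
    simp [this]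
  have hn : ∀ k i j, ‖T k i j‖ = ‖T k j i‖ := by
    intro k i j; rw [ha k i j, norm_neg]
  have hz' : ∀ k i, T k i i = 0 := fun k i => norm_eq_zero.mp (hz k i)
  have d1 := hd 1
  have d2 := hd 2
  have d3 := hd 3
  simp only [Fin.sum_univ_four, hz', add_zero] at d1 d2 d3
  have e1 := kato_two _ _ _ d1
  have e2 := kato_two _ _ _ d2
  have e3 := kato_two _ _ _ d3
  have b1 := kato_two _ _ _ (hc 0 1 2)
  have b2 := kato_two _ _ _ (hc 0 1 3)
  have b3 := kato_two _ _ _ (hc 0 2 3)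
  have p : ∀ k i j, 0 ≤ ‖T k i j‖ ^ 2 := fun k i j => sq_nonneg _
  simp only [Fin.sum_univ_four, hz, hn _ 1 0, hn _ 2 0, hn _ 3 0, hn _ 2 1, hn _ 3 1, hn _ 3 2]
    at *
  linarith [p 1 0 1, p 2 0 2, p 3 0 3, p 1 2 3, p 2 1 3, p 3 1 2]

/-- Action of a matrix on one index. -/
lemma kato_norm (R : Fin 4 → Fin 4 → ℝ) (N : ℝ)
    (hR : ∀ l m, ∑ k, R k l * R k m = if l = m then N else 0) (f : Fin 4 → V) :
    ∑ k, ‖∑ l, R k l • f l‖ ^ 2 = N * ∑ l, ‖f l‖ ^ 2 := by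
  have h1 : ∀ k, ‖∑ l, R k l • f l‖ ^ 2 = ∑ l, ∑ m, R k l * R k m * inner ℝ (f l) (f m) := by
    intro k
    rw [← real_inner_self_eq_norm_sq, sum_inner]
    refine Finset.sum_congr rfl fun l _ => ?_
    rw [inner_sum]
    refine Finset.sum_congr rfl fun m _ => ?_
    rw [real_inner_smul_left, real_inner_smul_right]; ring
  simp only [h1]
  rw [Finset.sum_comm, Finset.mul_sum]
  refine Finset.sum_congr rfl fun l _ => ?_
  rw [Finset.sum_comm]
  simp only [← Finset.sum_mul, hR, ite_mul, zero_mul, Finset.sum_ite_eq, Finset.mem_univ, if_true,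
    real_inner_self_eq_norm_sq]

lemma kato_rot (R : Fin 4 → Fin 4 → ℝ) (N : ℝ)
    (hR : ∀ l m, ∑ k, R k l * R k m = if l = m then N else 0)
    (D : Fin 4 → Fin 4 → Fin 4 → V)
    (ha : ∀ k i j, D k i j = - D k j i)
    (hc : ∀ i j k, D i j k + D j k i + D k i j = 0)
    (hd : ∀ j, ∑ i, D i i j = 0) (hN : 0 < N) :
    3 / 2 * ∑ i, ∑ j, ‖∑ k, R 0 k • D k i j‖ ^ 2 ≤ N * ∑ k, ∑ i, ∑ j, ‖D k i j‖ ^ 2 := by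
  have hT : ∃ T : Fin 4 → Fin 4 → Fin 4 → V, ∀ k i j,
    T k i j = ∑ n, R j n • ∑ m, R i m • ∑ l, R k l • D l m n := ⟨_, fun _ _ _ => rfl⟩
  obtain ⟨T, hT⟩ := hT
  have hT1 : ∀ k i j, T k i j = ∑ l, ∑ m, ∑ n, (R k l * R i m * R j n) • D l m n := by
    intro k i j
    rw [hT]
    simp only [Finset.smul_sum, smul_smul]
    rw [Finset.sum_comm]
    rw [Finset.sum_comm_cycle]
    refine Finset.sum_congr rfl fun l _ => Finset.sum_congr rfl fun m _ =>
      Finset.sum_congr rfl fun n _ => ?_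
    congr 1; ring
  have key := kato_base T ?_ ?_ ?_
  · -- norms
    have n0 : ∀ k, ∑ i, ∑ j, ‖T k i j‖ ^ 2 = N * (N * ∑ i, ∑ j, ‖∑ l, R k l • D l i j‖ ^ 2) := by
      intro k
      simp only [hT]
      simp only [kato_norm R N hR]
      rw [← Finset.mul_sum, Finset.sum_comm]
      simp only [kato_norm R N hR]
      rw [← Finset.mul_sum, Finset.sum_comm]
    simp only [n0] at key
    have n1 : ∑ k, ∑ i, ∑ j, ‖∑ l, R k l • D l i j‖ ^ 2 = N * ∑ k, ∑ i, ∑ j, ‖D k i j‖ ^ 2 := by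
      rw [Finset.sum_comm, Finset.sum_comm (f := fun k i => ∑ j, ‖D k i j‖ ^ 2), Finset.mul_sum]
      refine Finset.sum_congr rfl fun i _ => ?_
      rw [Finset.sum_comm, Finset.sum_comm (f := fun k j => ‖D k i j‖ ^ 2), Finset.mul_sum]
      refine Finset.sum_congr rfl fun j _ => ?_
      rw [kato_norm R N hR]
    rw [← Finset.mul_sum, ← Finset.mul_sum, n1] at key
    have hNN : 0 < N * N := by positivity
    refine le_of_mul_le_mul_left ?_ hNN
    linarith
  · intro k i j
    rw [hT1, hT1, ← Finset.sum_neg_distrib]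
    refine Finset.sum_congr rfl fun l _ => ?_
    rw [Finset.sum_comm, ← Finset.sum_neg_distrib]
    refine Finset.sum_congr rfl fun m _ => ?_
    rw [← Finset.sum_neg_distrib]
    refine Finset.sum_congr rfl fun n _ => ?_
    rw [ha, smul_neg]
    congr 2; ring
  · intro i j k
    have c1 : T j k i = ∑ l, ∑ m, ∑ n, (R i l * R j m * R k n) • D m n l := by
      rw [hT1, Finset.sum_comm_cycle]
      rw [Finset.sum_comm_cycle]
      rw [Finset.sum_comm_cycle]
      rw [Finset.sum_comm_cycle]
      refine Finset.sum_congr rfl fun l _ => Finset.sum_congr rfl fun m _ =>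
        Finset.sum_congr rfl fun n _ => ?_
      congr 1; ring
    have c2 : T k i j = ∑ l, ∑ m, ∑ n, (R i l * R j m * R k n) • D n l m := by
      rw [hT1, Finset.sum_comm_cycle]
      rw [Finset.sum_comm_cycle]
      refine Finset.sum_congr rfl fun l _ => Finset.sum_congr rfl fun m _ =>
        Finset.sum_congr rfl fun n _ => ?_
      congr 1; ring
    rw [c1, c2, hT1]
    simp only [← Finset.sum_add_distrib, ← smul_add, hc, smul_zero, Finset.sum_const_zero]
  · intro j
    have : ∀ l m, ∑ k, R k l * R k m = if l = m then N else 0 := hR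
    simp only [hT1]
    rw [Finset.sum_comm]
    have : ∀ l, ∑ k, ∑ m, ∑ n, (R k l * R k m * R j n) • D l m n
        = ∑ n, (N * R j n) • D l l n := by
      intro l
      rw [Finset.sum_comm, Finset.sum_eq_single l]
      · rw [Finset.sum_comm]
        refine Finset.sum_congr rfl fun n _ => ?_
        rw [← Finset.sum_smul, ← Finset.sum_mul, hR, if_pos rfl]
      · intro m _ hm
        rw [Finset.sum_comm]
        refine Finset.sum_eq_zero fun n _ => ?_
        rw [← Finset.sum_smul, ← Finset.sum_mul, hR, if_neg (Ne.symm hm), zero_mul, zero_smul]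
      · simp
    simp only [this]
    rw [Finset.sum_comm]
    simp only [← Finset.smul_sum, hd, smul_zero, Finset.sum_const_zero]

lemma kato_alg (v : Fin 4 → ℝ)
    (D : Fin 4 → Fin 4 → Fin 4 → V)
    (ha : ∀ k i j, D k i j = - D k j i)
    (hc : ∀ i j k, D i j k + D j k i + D k i j = 0)
    (hd : ∀ j, ∑ i, D i i j = 0) (hN : 0 < ∑ k, v k ^ 2) :
    3 / 2 * ∑ i, ∑ j, ‖∑ k, v k • D k i j‖ ^ 2
      ≤ (∑ k, v k ^ 2) * ∑ k, ∑ i, ∑ j, ‖D k i j‖ ^ 2 := by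
  refine kato_rot ![v, ![-v 1, v 0, -v 3, v 2], ![-v 2, v 3, v 0, -v 1],
    ![-v 3, -v 2, v 1, v 0]] _ ?_ D ha hc hd hN
  intro l m
  fin_cases l <;> fin_cases m <;> simp [Fin.sum_univ_four] <;> ring

end KatoAux




/-- Improved Kato inequality (Proposition 2.8 of the paper, flat case): for a
`C²` harmonic (closed and co-closed) `V`-valued 2-form `ω` on `ℝ⁴`, at every
point where `ω ≠ 0` the pointwise norm `|ω|` is differentiable and
`|∇ω|² ≥ (3/2) |d|ω||²`. -/
theorem improved_kato_inequality
    (V : Type*) [NormedAddCommGroup V] [InnerProductSpace ℝ V]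
    (ω : Fin 4 → Fin 4 → (EuclideanSpace ℝ (Fin 4) → V))
    (hC2 : ∀ i j, ContDiff ℝ 2 (ω i j))
    (hanti : ∀ i j, ω i j = -ω j i)
    (hclosed : ∀ (x : EuclideanSpace ℝ (Fin 4)) (i j k : Fin 4),
      fderiv ℝ (ω j k) x (EuclideanSpace.single i 1) +
        fderiv ℝ (ω k i) x (EuclideanSpace.single j 1) +
        fderiv ℝ (ω i j) x (EuclideanSpace.single k 1) = 0)
    (hcoclosed : ∀ (x : EuclideanSpace ℝ (Fin 4)) (j : Fin 4),
      ∑ i : Fin 4, fderiv ℝ (ω i j) x (EuclideanSpace.single i 1) = 0)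
    (x : EuclideanSpace ℝ (Fin 4)) (hx : ∃ i j, ω i j x ≠ 0) :
    DifferentiableAt ℝ
      (fun y => Real.sqrt (∑ i : Fin 4, ∑ j : Fin 4, ‖ω i j y‖ ^ 2)) x ∧
    ∑ k : Fin 4, ∑ i : Fin 4, ∑ j : Fin 4,
        ‖fderiv ℝ (ω i j) x (EuclideanSpace.single k 1)‖ ^ 2 ≥
      3 / 2 * ‖gradient
        (fun y => Real.sqrt (∑ i : Fin 4, ∑ j : Fin 4, ‖ω i j y‖ ^ 2)) x‖ ^ 2 := by
  set S : EuclideanSpace ℝ (Fin 4) → ℝ := fun y => ∑ i : Fin 4, ∑ j : Fin 4, ‖ω i j y‖ ^ 2 with hS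
  have hSpos : 0 < S x := by
    obtain ⟨i, j, hij⟩ := hx
    refine Finset.sum_pos' (fun i _ => Finset.sum_nonneg fun j _ => sq_nonneg _)
      ⟨i, Finset.mem_univ _, Finset.sum_pos' (fun j _ => sq_nonneg _)
        ⟨j, Finset.mem_univ _, by positivity⟩⟩
  have hdω : ∀ i j, HasFDerivAt (ω i j) (fderiv ℝ (ω i j) x) x := fun i j =>
    ((hC2 i j).differentiable (by norm_num) x).hasFDerivAt
  have hSd := HasFDerivAt.fun_sum (u := Finset.univ) fun (i : Fin 4) _ =>
    HasFDerivAt.fun_sum (u := Finset.univ) fun (j : Fin 4) _ => (hdω i j).norm_sq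
  have hFd := HasFDerivAt.sqrt hSd hSpos.ne'
  refine ⟨hFd.differentiableAt, ?_⟩
  set F : EuclideanSpace ℝ (Fin 4) → ℝ := fun y => Real.sqrt (S y) with hF
  set g := gradient F x with hg
  have hFpos : 0 < F x := Real.sqrt_pos.mpr hSpos
  have hFsq : F x ^ 2 = S x := Real.sq_sqrt hSpos.le
  have hgg : F x * ‖g‖ ^ 2 = ∑ i, ∑ j, inner ℝ (ω i j x) (fderiv ℝ (ω i j) x g) := by
    have h1 : ‖g‖ ^ 2 = fderiv ℝ F x g := by
      rw [← real_inner_self_eq_norm_sq]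
      conv_lhs => rw [hg]
      rw [gradient, InnerProductSpace.toDual_symm_apply, hg, gradient]
    rw [h1, hFd.fderiv]
    simp only [smul_apply, sum_apply,
      ContinuousLinearMap.comp_apply, innerSL_apply_apply, smul_eq_mul, nsmul_eq_mul,
      ← Finset.mul_sum, Nat.cast_ofNat]
    change F x * (1 / (2 * F x) * _) = _
    field_simp
  clear_value g
  have hcs : (F x * ‖g‖ ^ 2) ^ 2 ≤ S x * ∑ i, ∑ j, ‖fderiv ℝ (ω i j) x g‖ ^ 2 := by
    have h0 : 0 ≤ F x * ‖g‖ ^ 2 := by positivity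
    have h1 : F x * ‖g‖ ^ 2 ≤ ∑ p : Fin 4 × Fin 4, ‖ω p.1 p.2 x‖ * ‖fderiv ℝ (ω p.1 p.2) x g‖ := by
      rw [hgg, Fintype.sum_prod_type]
      exact Finset.sum_le_sum fun i _ => Finset.sum_le_sum fun j _ => real_inner_le_norm _ _
    have h2 := Finset.sum_mul_sq_le_sq_mul_sq (Finset.univ : Finset (Fin 4 × Fin 4))
      (fun p => ‖ω p.1 p.2 x‖) (fun p => ‖fderiv ℝ (ω p.1 p.2) x g‖)
    refine (pow_le_pow_left₀ h0 h1 2).trans (h2.trans_eq ?_)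
    simp only [Fintype.sum_prod_type, hS]
  have hgs : ∑ k, g k ^ 2 = ‖g‖ ^ 2 := by
    rw [EuclideanSpace.norm_sq_eq]; simp
  by_cases hg0 : g = 0
  · rw [hg0, norm_zero, ge_iff_le]
    have : (0 : ℝ) ≤ ∑ k : Fin 4, ∑ i : Fin 4, ∑ j : Fin 4,
        ‖fderiv ℝ (ω i j) x (EuclideanSpace.single k 1)‖ ^ 2 :=
      Finset.sum_nonneg fun k _ => Finset.sum_nonneg fun i _ => Finset.sum_nonneg fun j _ =>
        sq_nonneg _
    linarith
  have hgpos : 0 < ‖g‖ ^ 2 := pow_pos (norm_pos_iff.mpr hg0) 2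
  have hexp : ∀ i j, fderiv ℝ (ω i j) x g
      = ∑ k, g k • fderiv ℝ (ω i j) x (EuclideanSpace.single k 1) := by
    intro i j
    have h : g = ∑ k, g k • (EuclideanSpace.single k 1 : EuclideanSpace ℝ (Fin 4)) := by
      ext m
      fin_cases m <;> simp [Fin.sum_univ_four]
    conv_lhs => rw [h]
    simp only [map_sum, map_smul]
  have key := kato_alg (fun k => g k)
    (fun k i j => fderiv ℝ (ω i j) x (EuclideanSpace.single k 1))
    (fun k i j => by rw [hanti i j, fderiv_neg]; simp)
    (fun i j k => hclosed x i j k) (fun j => hcoclosed x j) (by rw [hgs]; exact hgpos)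
  simp only [← hexp] at key
  rw [hgs] at key
  rw [mul_pow, hFsq] at hcs
  have hcs' := le_of_mul_le_mul_left hcs hSpos
  refine le_of_mul_le_mul_left ?_ hgpos
  nlinarith
end
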